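/- arXiv:1212.6735 — 2 statements merged into one kernel-verified Lean document; each statement's English description precedes it below -/
import Mathlib

section
/- For every integer k ≥ 1, the vertex set of any edge-coloured graph G on n vertices with δ₁^c(G) ≥ 2n/3 + k can be covered by at most ⌊2n/k⌋ vertex-disjoint properly coloured paths. -/
open SimpleGraph

/-- A list of vertices forms a properly coloured walk: consecutive vertices are
adjacent and consecutive edges receive different colours. -/
def IsPCWalk {V : Type*} (G : SimpleGraph V) (c : V → V → ℕ) : List V → Prop
  | a :: b :: d :: rest => G.Adj a b ∧ c a b ≠ c b d ∧ IsPCWalk G c (b :: d :: rest)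
  | [a, b] => G.Adj a b
  | _ => True

/-- A properly coloured path: distinct vertices forming a properly coloured walk. -/
def IsPCPath {V : Type*} (G : SimpleGraph V) (c : V → V → ℕ) (l : List V) : Prop :=
  l.Nodup ∧ IsPCWalk G c l

/-- A properly coloured cycle, given as a list of (distinct) vertices of length ≥ 3;
closing the cycle by appending the first two vertices ensures all adjacencies and
colour conditions, including around the wrap-around vertex. -/
def IsPCCycle {V : Type*} (G : SimpleGraph V) (c : V → V → ℕ) (l : List V) : Prop :=
  3 ≤ l.length ∧ l.Nodup ∧ IsPCWalk G c (l ++ l.take 2)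

/-- The colour degree of `v`: the number of distinct colours on edges at `v`. -/
noncomputable def colourDeg {V : Type*} (G : SimpleGraph V) (c : V → V → ℕ) (v : V) : ℕ :=
  ((c v) '' {w | G.Adj v w}).ncard

/-- `colourDeg1 G c v a`: the number of edges at `v` whose colour differs from `a`.
`δ₁^c(G) ≥ k` is then `∀ v a, k ≤ colourDeg1 G c v a`. -/
noncomputable def colourDeg1 {V : Type*} (G : SimpleGraph V) (c : V → V → ℕ) (v : V) (a : ℕ) : ℕ :=
  {w | G.Adj v w ∧ c v w ≠ a}.ncard

section Walks

variable {V : Type*} {G : SimpleGraph V} {c : V → V → ℕ}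

/-- The colour `a` differs from the colour of the first edge of the walk (if there is one). -/
def FreeAtHead (c : V → V → ℕ) : List V → ℕ → Prop
  | x :: y :: _, a => c x y ≠ a
  | _, _ => True

theorem exists_forall_ne_freeAtHead (c : V → V → ℕ) (l : List V) :
    ∃ a, ∀ b, b ≠ a → FreeAtHead c l b := by
  match l with
  | x :: y :: _ => exact ⟨c x y, fun b hb => hb.symm⟩
  | [] => exact ⟨0, fun _ _ => trivial⟩
  | [_] => exact ⟨0, fun _ _ => trivial⟩

theorem IsPCWalk.cons {x y : V} {l : List V} (hl : IsPCWalk G c (y :: l)) (h : G.Adj x y)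
    (hf : FreeAtHead c (y :: l) (c x y)) : IsPCWalk G c (x :: y :: l) := by
  cases l with
  | nil => exact h
  | cons z l => exact ⟨h, Ne.symm hf, hl⟩

theorem IsPCWalk.of_cons {x : V} {l : List V} (hl : IsPCWalk G c (x :: l)) : IsPCWalk G c l := by
  match l with
  | [] => trivial
  | [_] => trivial
  | y :: z :: l => exact hl.2.2

theorem IsPCWalk.adj {x y : V} {l : List V} (hl : IsPCWalk G c (x :: y :: l)) : G.Adj x y := by
  cases l with
  | nil => exact hl
  | cons z l => exact hl.1

theorem IsPCWalk.freeAtHead {x y : V} {l : List V} (hl : IsPCWalk G c (x :: y :: l)) :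
    FreeAtHead c (y :: l) (c x y) := by
  cases l with
  | nil => trivial
  | cons z l => exact hl.2.1.symm

theorem IsPCWalk.of_append_right {l₁ l₂ : List V} (h : IsPCWalk G c (l₁ ++ l₂)) :
    IsPCWalk G c l₂ := by
  induction l₁ with
  | nil => exact h
  | cons a l ih => exact ih h.of_cons

/-- Two properly coloured walks whose heads are adjacent can be glued along that edge. -/
theorem IsPCWalk.reverse_append (hc : ∀ u v, c u v = c v u) {x y : V} {l₁ l₂ : List V}
    (h₁ : IsPCWalk G c (x :: l₁)) (h₂ : IsPCWalk G c (y :: l₂)) (h : G.Adj x y)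
    (hf₁ : FreeAtHead c (x :: l₁) (c x y)) (hf₂ : FreeAtHead c (y :: l₂) (c x y)) :
    IsPCWalk G c ((x :: l₁).reverse ++ y :: l₂) := by
  induction l₁ generalizing x y l₂ with
  | nil => exact h₂.cons h hf₂
  | cons z l₁ ih =>
    have key := ih h₁.of_cons (h₂.cons h hf₂) h₁.adj.symm
      (by rw [hc z x]; exact h₁.freeAtHead)
      (by rw [hc z x]; exact Ne.symm hf₁)
    simpa using key

theorem IsPCWalk.reverse (hc : ∀ u v, c u v = c v u) {l : List V} (h : IsPCWalk G c l) :
    IsPCWalk G c l.reverse := by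
  match l with
  | [] => exact h
  | [_] => exact h
  | x :: y :: l =>
    have key := h.of_cons.reverse_append hc (y := x) (l₂ := []) trivial h.adj.symm
      (by rw [hc y x]; exact h.freeAtHead) trivial
    simpa using key

theorem IsPCWalk.of_append_left_reverse (hc : ∀ u v, c u v = c v u) {l₁ l₂ : List V} {v : V}
    (h : IsPCWalk G c (l₁ ++ v :: l₂)) : IsPCWalk G c (v :: l₁.reverse) := by
  have h' := h.reverse hc
  simp only [List.reverse_append, List.reverse_cons, List.append_assoc, List.singleton_append] at h'
  exact h'.of_append_right

/-- At an inner vertex of a properly coloured walk, a given colour is missed by one of the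
two incident edges of the walk. -/
theorem IsPCWalk.freeAtHead_or (hc : ∀ u v, c u v = c v u) {l₁ l₂ : List V} {v : V}
    (h : IsPCWalk G c (l₁ ++ v :: l₂)) (a : ℕ) :
    FreeAtHead c (v :: l₁.reverse) a ∨ FreeAtHead c (v :: l₂) a := by
  rcases List.eq_nil_or_concat l₁ with rfl | ⟨l, z, rfl⟩
  · exact Or.inl trivial
  cases l₂ with
  | nil => exact Or.inr trivial
  | cons w l₂ =>
    have h' : IsPCWalk G c (l ++ z :: v :: w :: l₂) := by simpa using h
    have h3 := h'.of_append_right.2.1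
    simp only [List.concat_eq_append, List.reverse_append, List.reverse_cons, List.reverse_nil,
      List.nil_append, List.singleton_append, FreeAtHead]
    rw [hc v z]
    by_contra! hcon
    exact h3 (hcon.1.trans hcon.2.symm)

end Walks

section Counting

open Finset Classical

variable {V ι : Type*}

/-- The members of `W` on which `u` takes a value that it takes nowhere else on `W`. -/
noncomputable def uniqueFibre (W : Finset V) (u : V → V) : Finset V :=
  W.filter fun i => ∀ i' ∈ W, u i' = u i → i' = i

theorem card_uniqueFibre_lt {W N : Finset V} {u : V → V} {comp : V → ι} {b : ℕ} {q : ι}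
    (hN : #N ≤ b) (hfib : ∀ v, #{i ∈ W | u i = v} ≤ 2)
    (hW : 2 * b + #{i ∈ W | comp i = q} < #W)
    (hD : ∀ i ∈ W, ∀ i' ∈ W, comp i ≠ q → i' ≠ i → u i' = u i → u i ∈ N) :
    #{i ∈ uniqueFibre W u | comp i ≠ q} <
      2 * #{i ∈ uniqueFibre W u | comp i ≠ q ∧ u i ∉ N} := by
  set S := uniqueFibre W u with hS
  set D := {i ∈ W | i ∉ S ∧ comp i ≠ q} with hDdef
  set T := {i ∈ S | comp i ≠ q ∧ u i ∈ N} with hT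
  have hSW : ∀ i ∈ S, i ∈ W := fun i hi => (mem_filter.1 hi).1
  have hSu : ∀ i ∈ S, ∀ i' ∈ W, u i' = u i → i' = i := fun i hi => (mem_filter.1 hi).2
  have h1 : #{i ∈ S | comp i ≠ q} = #T + #{i ∈ S | comp i ≠ q ∧ u i ∉ N} := by
    rw [← card_filter_add_card_filter_not (s := {i ∈ S | comp i ≠ q}) (fun i => u i ∈ N),
      filter_filter, filter_filter]
  have h2 : #W = #{i ∈ W | comp i = q} + (#{i ∈ S | comp i ≠ q} + #D) := by
    rw [← card_filter_add_card_filter_not (s := W) (fun i => comp i = q),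
      ← card_filter_add_card_filter_not (s := {i ∈ W | ¬ comp i = q}) (fun i => i ∈ S),
      filter_filter, filter_filter]
    congr 3
    · ext i; simp only [mem_filter]; have := hSW i; tauto
    · ext i; simp only [hDdef, mem_filter]; tauto
  have h3 : #D ≤ 2 * #(D.image u) := by
    refine card_le_mul_card_image _ _ fun v _ => (card_le_card ?_).trans (hfib v)
    exact filter_subset_filter _ (filter_subset _ _)
  have h4 : #(T.image u) = #T :=
    card_image_of_injOn fun i hi i' hi' h =>
      hSu i' (mem_filter.1 hi').1 i (hSW i (mem_filter.1 hi).1) h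
  have h5 : Disjoint (T.image u) (D.image u) := by
    rw [Finset.disjoint_left]
    intro v hv hv'
    obtain ⟨i, hi, rfl⟩ := mem_image.1 hv
    obtain ⟨i', hi', h⟩ := mem_image.1 hv'
    have hi'W := mem_filter.1 hi'
    have := hSu i (mem_filter.1 hi).1 i' hi'W.1 h
    exact hi'W.2.1 (this ▸ (mem_filter.1 hi).1)
  have h6 : T.image u ∪ D.image u ⊆ N := by
    refine union_subset (image_subset_iff.2 fun i hi => (mem_filter.1 hi).2.2)
      (image_subset_iff.2 fun i hi => ?_)
    obtain ⟨hiW, hiS, hiq⟩ := mem_filter.1 hi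
    have : ∃ i' ∈ W, u i' = u i ∧ i' ≠ i := by
      by_contra! hcon
      exact hiS (mem_filter.2 ⟨hiW, hcon⟩)
    obtain ⟨i', hi', hu, hne⟩ := this
    exact hD i hiW i' hi' hiq hne hu
  have h7 := card_le_card h6
  rw [card_union_of_disjoint h5] at h7
  omega

/-- If every member of `Wx` reaches all but few vertices and vice versa, where vertices hit twice
count with multiplicity two, then some two members in different components reach each other. -/
theorem exists_mutual {Wx Wy : Finset V} {ux uy : V → V} {Nx Ny : V → Finset V} {comp : V → ι}
    {b : ℕ} (hNx : ∀ i ∈ Wx, #(Nx i) ≤ b) (hNy : ∀ j ∈ Wy, #(Ny j) ≤ b)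
    (hfx : ∀ v, #{i ∈ Wx | ux i = v} ≤ 2) (hfy : ∀ v, #{j ∈ Wy | uy j = v} ≤ 2)
    (hWx : ∀ q, 2 * b + #{i ∈ Wx | comp i = q} < #Wx)
    (hWy : ∀ q, 2 * b + #{j ∈ Wy | comp j = q} < #Wy)
    (hcx : ∀ i ∈ Wx, ∀ i' ∈ Wx, ux i' = ux i → comp i' = comp i)
    (hcy : ∀ j ∈ Wy, ∀ j' ∈ Wy, uy j' = uy j → comp j' = comp j)
    (hDx : ∀ i ∈ Wx, ∀ i' ∈ Wx, i' ≠ i → ux i' = ux i → ∀ j ∈ Wy, ux i ∉ Ny j →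
      uy j ∉ Nx i ∨ uy j ∉ Nx i')
    (hDy : ∀ j ∈ Wy, ∀ j' ∈ Wy, j' ≠ j → uy j' = uy j → ∀ i ∈ Wx, uy j ∉ Nx i →
      ux i ∉ Ny j ∨ ux i ∉ Ny j') (q : ι) :
    ∃ i ∈ Wx, ∃ j ∈ Wy, comp i ≠ comp j ∧ uy j ∉ Nx i ∧ ux i ∉ Ny j := by
  by_contra! hcon
  set Sx := uniqueFibre Wx ux
  set Sy := uniqueFibre Wy uy
  have hSx : ∀ i ∈ Sx, i ∈ Wx := fun i hi => (mem_filter.1 hi).1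
  have hSy : ∀ i ∈ Sy, i ∈ Wy := fun i hi => (mem_filter.1 hi).1
  have hx : ∀ j ∈ Wy, #{i ∈ Sx | comp i ≠ comp j} <
      2 * #{i ∈ Sx | comp i ≠ comp j ∧ ux i ∉ Ny j} := fun j hj =>
    card_uniqueFibre_lt (hNy j hj) hfx (hWx _) fun i hi i' hi' hq hne hu => by
      by_contra hN
      rcases hDx i hi i' hi' hne hu j hj hN with h | h
      · exact hN (hcon i hi j hj hq h)
      · refine hN (hu ▸ hcon i' hi' j hj ?_ h)
        rwa [hcx i hi i' hi' hu]
  have hy : ∀ i ∈ Wx, #{j ∈ Sy | comp j ≠ comp i} <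
      2 * #{j ∈ Sy | comp j ≠ comp i ∧ uy j ∉ Nx i} := fun i hi =>
    card_uniqueFibre_lt (hNx i hi) hfy (hWy _) fun j hj j' hj' hq hne hu => by
      by_contra hN
      rcases hDy j hj j' hj' hne hu i hi hN with h | h
      · exact h (hcon i hi j hj hq.symm hN)
      · refine h (hcon i hi j' hj' ?_ (hu ▸ hN))
        rw [hcy j hj j' hj' hu]; exact hq.symm
  have hSxne : Sx.Nonempty := by
    obtain ⟨j, hj⟩ : Wy.Nonempty := card_pos.1 ((Nat.zero_le _).trans_lt (hWy q))
    have := hx j hj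
    obtain ⟨i, hi⟩ := card_pos.1 (show 0 < #{i ∈ Sx | comp i ≠ comp j ∧ ux i ∉ Ny j} by omega)
    exact ⟨i, (mem_filter.1 hi).1⟩
  have hSyne : Sy.Nonempty := by
    obtain ⟨i, hi⟩ := hSxne
    have := hy i (hSx i hi)
    obtain ⟨j, hj⟩ := card_pos.1 (show 0 < #{j ∈ Sy | comp j ≠ comp i ∧ uy j ∉ Nx i} by omega)
    exact ⟨j, (mem_filter.1 hj).1⟩
  have sx := sum_lt_sum_of_nonempty hSyne fun j hj => hx j (hSy j hj)
  have sy := sum_lt_sum_of_nonempty hSxne fun i hi => hy i (hSx i hi)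
  simp only [← mul_sum, card_filter] at sx sy
  rw [sum_comm, sum_comm (s := Sy)] at sx
  have hsum : (∑ i ∈ Sx, ∑ j ∈ Sy, if comp i ≠ comp j ∧ ux i ∉ Ny j then 1 else 0) +
      (∑ i ∈ Sx, ∑ j ∈ Sy, if comp j ≠ comp i ∧ uy j ∉ Nx i then 1 else 0) ≤
      ∑ i ∈ Sx, ∑ j ∈ Sy, if comp j ≠ comp i then 1 else 0 := by
    simp only [← sum_add_distrib]
    refine sum_le_sum fun i hi => sum_le_sum fun j hj => ?_
    have := hcon i (hSx i hi) j (hSy j hj)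
    by_cases h : comp i = comp j
    · simp [h]
    · have h' : comp j ≠ comp i := Ne.symm h
      by_cases h1 : uy j ∈ Nx i
      · by_cases h2 : ux i ∈ Ny j <;> simp [h, h', h1, h2]
      · simp [h, h', h1, this h h1]
  have heq : (∑ i ∈ Sx, ∑ j ∈ Sy, if comp i ≠ comp j then 1 else 0) =
      ∑ i ∈ Sx, ∑ j ∈ Sy, if comp j ≠ comp i then 1 else 0 := by
    simp only [ne_comm]
  omega

end Counting

section Covers

open Finset Classical

variable {V : Type*} {G : SimpleGraph V} {c : V → V → ℕ}

/-- A list of vertex-disjoint nonempty properly coloured paths covering all the vertices. -/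
structure IsPCCover (G : SimpleGraph V) (c : V → V → ℕ) (L : List (List V)) : Prop where
  walk : ∀ l ∈ L, IsPCWalk G c l
  ne_nil : ∀ l ∈ L, l ≠ []
  nodup : L.flatten.Nodup
  mem : ∀ v, v ∈ L.flatten

/-- The sum of the squares of the lengths of the members of a list of lists. -/
def sumSqLength (L : List (List V)) : ℕ :=
  (L.map fun l => l.length ^ 2).sum

/-- A cover with the fewest paths and, among those, of the most balanced lengths. -/
structure IsOptimalCover (G : SimpleGraph V) (c : V → V → ℕ) (L : List (List V)) : Prop
    extends IsPCCover G c L where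
  length_le : ∀ L', IsPCCover G c L' → L.length ≤ L'.length
  sumSqLength_le : ∀ L', IsPCCover G c L' → L'.length = L.length → sumSqLength L ≤ sumSqLength L'

theorem IsPCCover.of_perm {L L' : List (List V)} (h : IsPCCover G c L)
    (hp : L'.flatten.Perm L.flatten) (hw : ∀ l ∈ L', IsPCWalk G c l) (hn : ∀ l ∈ L', l ≠ []) :
    IsPCCover G c L' :=
  ⟨hw, hn, hp.nodup_iff.2 h.nodup, fun v => hp.mem_iff.2 (h.mem v)⟩

theorem IsPCCover.eq_of_mem {L : List (List V)} (h : IsPCCover G c L) {l l' : List V}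
    (hl : l ∈ L) (hl' : l' ∈ L) {v : V} (hv : v ∈ l) (hv' : v ∈ l') : l = l' := by
  by_contra hne
  have : Std.Symm (List.Disjoint (α := V)) := ⟨fun _ _ hd => hd.symm⟩
  exact (List.nodup_flatten.1 h.nodup).2.forall hl hl' hne hv hv'

theorem IsPCCover.nodup_of_mem {L : List (List V)} (h : IsPCCover G c L) {l : List V}
    (hl : l ∈ L) : l.Nodup :=
  (List.nodup_flatten.1 h.nodup).1 l hl

theorem IsPCCover.sum_length [Fintype V] {L : List (List V)} (h : IsPCCover G c L) :
    (L.map List.length).sum = Fintype.card V := by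
  rw [← List.length_flatten, ← List.toFinset_card_of_nodup h.nodup, ← card_univ]
  congr 1
  ext v
  simpa using h.mem v

theorem IsOptimalCover.perm {L L' : List (List V)} (h : IsOptimalCover G c L)
    (hp : L'.Perm L) : IsOptimalCover G c L' where
  toIsPCCover := h.of_perm hp.flatten (fun l hl => h.walk l (hp.mem_iff.1 hl))
    fun l hl => h.ne_nil l (hp.mem_iff.1 hl)
  length_le L'' h'' := hp.length_eq ▸ h.length_le L'' h''
  sumSqLength_le L'' h'' hl := by
    have : sumSqLength L' = sumSqLength L := (hp.map _).sum_eq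
    rw [this]
    exact h.sumSqLength_le L'' h'' (hl.trans hp.length_eq)

theorem exists_isOptimalCover [Fintype V] (G : SimpleGraph V) (c : V → V → ℕ) :
    ∃ L, IsOptimalCover G c L := by
  have hne : ∃ L, IsPCCover G c L := by
    have hf : ((univ : Finset V).toList.map fun v => [v]).flatten = univ.toList := by
      simp [← List.flatMap_def]
    refine ⟨(univ : Finset V).toList.map fun v => [v], ?_, ?_, ?_, ?_⟩
    · intro l hl
      obtain ⟨v, -, rfl⟩ := List.mem_map.1 hl
      trivial
    · intro l hl
      obtain ⟨v, -, rfl⟩ := List.mem_map.1 hl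
      simp
    · rw [hf]; exact nodup_toList _
    · intro v; rw [hf]; simp
  obtain ⟨L, hL, hmin⟩ := WellFounded.has_min
    (InvImage.wf (fun L : List (List V) => toLex (L.length, sumSqLength L)) wellFounded_lt)
    {L | IsPCCover G c L} hne
  refine ⟨L, hL, fun L' hL' => ?_, fun L' hL' hl => ?_⟩
  · by_contra! hlt
    exact hmin L' hL' (Prod.Lex.toLex_lt_toLex.2 (Or.inl hlt))
  · by_contra! hlt
    exact hmin L' hL' (Prod.Lex.toLex_lt_toLex.2 (Or.inr ⟨hl, hlt⟩))

/-- If a path of an optimal cover can be attached to a segment of another path, then what remains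
of the latter is nonempty and not longer than the former. -/
theorem IsOptimalCover.ne_nil_and_length_le {R : List (List V)} {P Q A U : List V} {v : V}
    (h : IsOptimalCover G c (P :: R)) (hQ : Q ∈ R) (hp : (A ++ v :: U).Perm Q)
    (hU : IsPCWalk G c U) (hA : IsPCWalk G c (A ++ v :: P)) :
    U ≠ [] ∧ U.length ≤ P.length := by
  obtain ⟨R', hR⟩ : ∃ R', R.Perm (Q :: R') := ⟨_, List.perm_cons_erase hQ⟩
  replace h := h.perm (hR.symm.cons P)
  have hR' : ∀ l ∈ R', IsPCWalk G c l ∧ l ≠ [] := fun l hl =>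
    ⟨h.walk l (by simp [hl]), h.ne_nil l (by simp [hl])⟩
  have hcount := fun a => hp.count_eq a
  have hne : U ≠ [] := by
    rintro rfl
    have := h.length_le ((A ++ v :: P) :: R') (h.of_perm ?_ ?_ ?_)
    · simp at this
    · rw [List.perm_iff_count]
      intro a
      have := hcount a
      simp only [List.flatten_cons, List.count_append, List.count_cons, List.count_nil] at this ⊢
      omega
    · simpa [hA] using fun l hl => (hR' l hl).1
    · simpa using fun l hl => (hR' l hl).2
  refine ⟨hne, ?_⟩
  have := h.sumSqLength_le ((A ++ v :: P) :: U :: R') (h.of_perm ?_ ?_ ?_) (by simp)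
  · simp only [sumSqLength, List.map_cons, List.sum_cons, ← hp.length_eq, List.length_append,
      List.length_cons] at this
    by_contra! hlt
    nlinarith [Nat.mul_le_mul_left (A.length + 1) hlt]
  · rw [List.perm_iff_count]
    intro a
    have := hcount a
    simp only [List.flatten_cons, List.count_append, List.count_cons] at this ⊢
    omega
  · simpa [hA, hU] using fun l hl => (hR' l hl).1
  · simpa [hne] using fun l hl => (hR' l hl).2

/-- The list itself or its reverse. -/
def orient (t : Bool) (l : List V) : List V :=
  if t then l else l.reverse

theorem orient_perm (t : Bool) (l : List V) : (orient t l).Perm l := by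
  cases t
  · exact l.reverse_perm
  · exact .refl l

theorem IsPCWalk.orient (hc : ∀ u v, c u v = c v u) {l : List V} (h : IsPCWalk G c l) (t : Bool) :
    IsPCWalk G c (orient t l) := by
  cases t
  · exact h.reverse hc
  · exact h

theorem IsOptimalCover.exists_release (hc : ∀ u v, c u v = c v u) {R : List (List V)}
    {x v : V} {P Q : List V} (h : IsOptimalCover G c ((x :: P) :: R)) (hQ : Q ∈ R) (hv : v ∈ Q)
    (hadj : G.Adj x v) (hf : FreeAtHead c (x :: P) (c x v)) :
    ∃ t A u U, orient t Q = A ++ v :: u :: U ∧ IsPCWalk G c (A ++ v :: x :: P) ∧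
      U.length ≤ P.length := by
  have key : ∀ t A U, orient t Q = A ++ v :: U → FreeAtHead c (v :: A.reverse) (c v x) →
      ∃ t A u U, orient t Q = A ++ v :: u :: U ∧ IsPCWalk G c (A ++ v :: x :: P) ∧
        U.length ≤ P.length := by
    intro t A U hAU hfA
    have hw : IsPCWalk G c (A ++ v :: U) := hAU ▸ (h.walk Q (by simp [hQ])).orient hc t
    have hA := (hw.of_append_left_reverse hc).reverse_append hc (h.walk (x :: P) (by simp))
      hadj.symm hfA (hc v x ▸ hf)
    simp only [List.reverse_cons, List.reverse_reverse, List.append_assoc,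
      List.singleton_append] at hA
    obtain ⟨hne, hle⟩ := h.ne_nil_and_length_le hQ (hAU ▸ orient_perm t Q)
      hw.of_append_right.of_cons hA
    obtain ⟨u, U, rfl⟩ := List.exists_cons_of_ne_nil hne
    exact ⟨t, A, u, U, hAU, hA, by simpa using hle⟩
  obtain ⟨A, B, rfl⟩ := List.append_of_mem hv
  rcases (h.walk _ (List.mem_cons_of_mem _ hQ)).freeAtHead_or hc (c v x) with hA | hB
  · exact key true A B rfl hA
  · exact key false B.reverse A.reverse (by simp [orient]) (by simpa using hB)

theorem List.Nodup.append_cons_inj {u : V} {A A' B B' : List V} (h : (A ++ u :: B).Nodup)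
    (he : A ++ u :: B = A' ++ u :: B') : A = A' ∧ B = B' := by
  have h' := he ▸ h
  have h1 : u ∉ A := fun hu => by
    simpa using (List.nodup_append.1 h).2.2 u hu u (by simp)
  have h2 : u ∉ A' := fun hu => by
    simpa using (List.nodup_append.1 h').2.2 u hu u (by simp)
  have hi : A.length = A'.length := by
    have e1 := congrArg (List.idxOf u) he
    simpa [List.idxOf_append_of_notMem, h1, h2] using e1
  obtain ⟨hA, hB⟩ := List.append_inj he hi
  exact ⟨hA, (List.cons.inj hB).2⟩

/-- The vertices that can be released by attaching the first path of an optimal cover at the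
vertices of `W`. -/
theorem IsOptimalCover.exists_release_family (hc : ∀ u v, c u v = c v u)
    {R : List (List V)} {x : V} {P : List V} (h : IsOptimalCover G c ((x :: P) :: R))
    {comp : V → List V} {W : Finset V} (hcomp : ∀ v ∈ W, comp v ∈ R ∧ v ∈ comp v)
    (hW : ∀ v ∈ W, G.Adj x v ∧ FreeAtHead c (x :: P) (c x v)) :
    ∃ (u : V → V) (U : V → List V),
      (∀ v ∈ W, ∃ t A, orient t (comp v) = A ++ v :: u v :: U v ∧
        IsPCWalk G c (A ++ v :: x :: P)) ∧
      (∀ z, #{v ∈ W | u v = z} ≤ 2) ∧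
      (∀ q, #{v ∈ W | comp v = q} ≤ 2 * (P.length + 1)) ∧
      (∀ v ∈ W, ∀ v' ∈ W, u v' = u v → comp v' = comp v) ∧
      (∀ v ∈ W, ∀ v' ∈ W, v' ≠ v → u v' = u v → ∀ a,
        FreeAtHead c (u v :: U v) a ∨ FreeAtHead c (u v' :: U v') a) := by
  have hex : ∀ v, ∃ t A u U, v ∈ W → orient t (comp v) = A ++ v :: u :: U ∧
      IsPCWalk G c (A ++ v :: x :: P) ∧ U.length ≤ P.length := by
    intro v
    by_cases hv : v ∈ W
    · obtain ⟨t, A, u, U, h'⟩ :=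
        h.exists_release hc (hcomp v hv).1 (hcomp v hv).2 (hW v hv).1 (hW v hv).2
      exact ⟨t, A, u, U, fun _ => h'⟩
    · exact ⟨true, [], v, [], fun hv' => absurd hv' hv⟩
  choose t A u U hrel using hex
  have hnd : ∀ v ∈ W, (comp v).Nodup := fun v hv =>
    h.nodup_of_mem (List.mem_cons_of_mem _ (hcomp v hv).1)
  have hmem : ∀ v ∈ W, u v ∈ comp v := fun v hv => by
    rw [← (orient_perm (t v) (comp v)).mem_iff, (hrel v hv).1]; simp
  have hcu : ∀ v ∈ W, ∀ v' ∈ W, u v' = u v → comp v' = comp v := fun v hv v' hv' he =>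
    h.eq_of_mem (List.mem_cons_of_mem _ (hcomp v' hv').1) (List.mem_cons_of_mem _ (hcomp v hv).1)
      (hmem v' hv') (he ▸ hmem v hv)
  have hinj : ∀ v ∈ W, ∀ v' ∈ W, u v' = u v → t v' = t v → v' = v := by
    intro v hv v' hv' he ht
    have h1 := (hrel v hv).1
    have h2 := (hrel v' hv').1
    rw [ht, hcu v hv v' hv' he, he, h1] at h2
    have hn : (A v ++ v :: u v :: U v).Nodup := h1 ▸ (orient_perm _ _).nodup_iff.2 (hnd v hv)
    have := (List.Nodup.append_cons_inj (u := u v) (A := A v ++ [v]) (B := U v)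
      (A' := A v' ++ [v']) (B' := U v') (by simpa using hn) (by simpa using h2)).1
    simpa using (List.append_inj' this rfl).2.symm
  refine ⟨u, U, fun v hv => ⟨t v, A v, (hrel v hv).1, (hrel v hv).2.1⟩, fun z => ?_, fun q => ?_,
    hcu, ?_⟩
  · have : #{v ∈ W | u v = z} ≤ #(univ : Finset Bool) :=
      card_le_card_of_injOn t (fun _ _ => mem_univ _) fun v hv v' hv' he => by
        simp only [coe_filter, Set.mem_ofPred_eq] at hv hv'
        exact hinj v' hv'.1 v hv.1 (hv.2.trans hv'.2.symm) he
    simpa using this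
  · have : #{v ∈ W | comp v = q} ≤ #((univ : Finset Bool) ×ˢ Finset.range (P.length + 1)) :=
      card_le_card_of_injOn (fun v => (t v, (U v).length))
        (fun v hv => by
          simp only [coe_filter, Set.mem_ofPred_eq] at hv
          simpa [Nat.lt_succ_iff] using (hrel v hv.1).2.2) fun v hv v' hv' he => by
        simp only [coe_filter, Set.mem_ofPred_eq, Prod.mk.injEq] at hv hv' he
        have h1 := (hrel v hv.1).1
        have h2 := (hrel v' hv'.1).1
        rw [hv'.2, ← hv.2, ← he.1, h1] at h2
        exact (List.cons.inj (List.append_inj' h2 (by simp [he.2])).2).1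
    simpa using this
  · intro v hv v' hv' hne he a
    have ht : t v' = !t v := by
      have := mt (hinj v hv v' hv' he) hne
      cases h1 : t v <;> cases h2 : t v' <;> simp_all
    have h1 := (hrel v hv).1
    have h2 := (hrel v' hv').1
    have hor : ∀ l : List V, orient (!t v) l = (orient (t v) l).reverse := fun l => by
      cases t v <;> simp [orient]
    have hw : IsPCWalk G c (A v ++ v :: u v :: U v) :=
      h1 ▸ (h.walk _ (List.mem_cons_of_mem _ (hcomp v hv).1)).orient hc _
    have hn : (A v ++ v :: u v :: U v).Nodup := h1 ▸ (orient_perm _ _).nodup_iff.2 (hnd v hv)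
    rw [ht, hor, hcu v hv v' hv' he, he, h1, ← List.reverse_inj, List.reverse_reverse] at h2
    have := (List.Nodup.append_cons_inj (u := u v) (A := A v ++ [v]) (B := U v)
      (A' := (U v').reverse) (B' := v' :: (A v').reverse) (by simpa using hn)
      (by simpa using h2)).1
    have hw' : IsPCWalk G c ((A v ++ [v]) ++ u v :: U v) := by simpa using hw
    rw [this] at hw'
    have := hw'.freeAtHead_or hc a
    rw [List.reverse_reverse] at this
    rw [he]
    exact this.symm

theorem length_mul_le_of_filter (k : ℕ) (L : List (List V)) :
    L.length * (3 * k) ≤ (L.filter fun l => 4 * l.length < 3 * k).length * (3 * k) +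
      4 * (L.map List.length).sum := by
  induction L with
  | nil => simp
  | cons l L ih =>
    by_cases hl : 4 * l.length < 3 * k
    · simp only [List.length_cons, List.map_cons, List.sum_cons, List.filter_cons, hl,
        decide_true, if_true]
      linarith
    · simp only [List.length_cons, List.map_cons, List.sum_cons, List.filter_cons, hl,
        decide_false, Bool.false_eq_true, if_false]
      linarith

theorem IsPCCover.exists_two_short [Fintype V] {L : List (List V)} (h : IsPCCover G c L) {k : ℕ}
    (hk : 3 * k ≤ Fintype.card V) (hL : 2 * Fintype.card V < L.length * k) :
    ∃ P P' R, L.Perm (P :: P' :: R) ∧ 4 * P.length < 3 * k ∧ 4 * P'.length < 3 * k := by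
  have h1 := length_mul_le_of_filter k L
  rw [h.sum_length] at h1
  have hp := (List.filter_append_perm (fun l : List V => 4 * l.length < 3 * k) L).symm
  have hs : ∀ l ∈ L.filter fun l => 4 * l.length < 3 * k, 4 * l.length < 3 * k := fun l hl => by
    simpa using (List.mem_filter.1 hl).2
  match hf : L.filter fun l => 4 * l.length < 3 * k with
  | [] => rw [hf] at h1; simp at h1; nlinarith
  | [_] => rw [hf] at h1; simp at h1; nlinarith
  | P :: P' :: S =>
    rw [hf] at hp hs
    exact ⟨P, P', _, hp, hs P (by simp), hs P' (by simp)⟩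

theorem card_not_reachable_le [Fintype V] {k : ℕ}
    (hδ : ∀ v a, 2 * Fintype.card V + 3 * k ≤ 3 * colourDeg1 G c v a) (u : V) (U : List V) :
    #{z | ¬ (G.Adj u z ∧ FreeAtHead c (u :: U) (c u z))} ≤ (Fintype.card V - 3 * k) / 3 := by
  obtain ⟨a, ha⟩ := exists_forall_ne_freeAtHead c (u :: U)
  have h1 := hδ u a
  have h2 : colourDeg1 G c u a ≤ #{z | G.Adj u z ∧ FreeAtHead c (u :: U) (c u z)} := by
    rw [colourDeg1, ← Set.ncard_coe_finset]
    exact Set.ncard_le_ncard (fun z hz => by simpa using ⟨hz.1, ha _ hz.2⟩)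
  have h3 := card_filter_add_card_filter_not (s := (univ : Finset V))
    (fun z => G.Adj u z ∧ FreeAtHead c (u :: U) (c u z))
  rw [card_univ] at h3
  omega

theorem le_card_attachable [Fintype V] {k : ℕ}
    (hδ : ∀ v a, 2 * Fintype.card V + 3 * k ≤ 3 * colourDeg1 G c v a) (x : V) (P : List V)
    (S : Finset V) :
    2 * Fintype.card V + 3 * k ≤
      3 * (#{v | v ∉ S ∧ G.Adj x v ∧ FreeAtHead c (x :: P) (c x v)} + #S) := by
  obtain ⟨a, ha⟩ := exists_forall_ne_freeAtHead c (x :: P)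
  refine (hδ x a).trans (Nat.mul_le_mul_left 3 ((?_ : _ ≤ _).trans (card_union_le _ _)))
  rw [colourDeg1, ← Set.ncard_coe_finset]
  refine Set.ncard_le_ncard fun z hz => ?_
  by_cases hzS : z ∈ S
  · simp [hzS]
  · simpa [hzS] using ⟨hz.1, ha _ hz.2⟩

/-- Two paths cannot be attached to two others in such a way that the released remainders can be
glued together. -/
theorem IsOptimalCover.not_glue (hc : ∀ u v, c u v = c v u) {P P' Q Q' A A' U U' : List V}
    {R : List (List V)} {v v' u u' : V} (h : IsOptimalCover G c (P :: P' :: R))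
    (hQ : Q ∈ R) (hQ' : Q' ∈ R) (hne : Q ≠ Q') (hp : (A ++ v :: u :: U).Perm Q)
    (hp' : (A' ++ v' :: u' :: U').Perm Q') (hw : IsPCWalk G c (A ++ v :: u :: U))
    (hw' : IsPCWalk G c (A' ++ v' :: u' :: U')) (hA : IsPCWalk G c (A ++ v :: P))
    (hA' : IsPCWalk G c (A' ++ v' :: P')) (hadj : G.Adj u u')
    (hf : FreeAtHead c (u :: U) (c u u')) (hf' : FreeAtHead c (u' :: U') (c u u')) : False := by
  obtain ⟨R', hR⟩ : ∃ R', R.Perm (Q :: Q' :: R') :=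
    ⟨_, (List.perm_cons_erase hQ).trans
      ((List.perm_cons_erase ((List.mem_erase_of_ne hne.symm).2 hQ')).cons Q)⟩
  replace h := h.perm ((hR.symm.cons P').cons P)
  have hglue := hw.of_append_right.of_cons.reverse_append hc hw'.of_append_right.of_cons hadj hf hf'
  have := h.length_le ((A ++ v :: P) :: (A' ++ v' :: P') :: ((u :: U).reverse ++ u' :: U') :: R')
    (h.of_perm ?_ ?_ ?_)
  · simp at this
  · rw [List.perm_iff_count]
    intro a
    have h1 := hp.count_eq a
    have h2 := hp'.count_eq a
    simp only [List.flatten_cons, List.count_append, List.count_reverse, List.count_cons]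
      at h1 h2 ⊢
    omega
  · intro l hl
    simp only [List.mem_cons] at hl
    rcases hl with rfl | rfl | rfl | hl
    · exact hA
    · exact hA'
    · exact hglue
    · exact h.walk l (by simp [hl])
  · intro l hl
    simp only [List.mem_cons] at hl
    rcases hl with rfl | rfl | rfl | hl
    · simp
    · simp
    · simp
    · exact h.ne_nil l (by simp [hl])

/-- An optimal cover has no two short paths. -/
theorem IsOptimalCover.not_two_short [Fintype V] (hc : ∀ u v, c u v = c v u) {k : ℕ}
    (hδ : ∀ v a, 2 * Fintype.card V + 3 * k ≤ 3 * colourDeg1 G c v a)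
    (hk : 3 * k ≤ Fintype.card V) {P P' : List V}
    {R : List (List V)} (h : IsOptimalCover G c (P :: P' :: R))
    (hP : 4 * P.length < 3 * k) (hP' : 4 * P'.length < 3 * k) : False := by
  obtain ⟨x, P, rfl⟩ := List.exists_cons_of_ne_nil (h.ne_nil P (by simp))
  obtain ⟨y, P', rfl⟩ := List.exists_cons_of_ne_nil (h.ne_nil P' (by simp))
  have h' := h.perm (.swap (x :: P) (y :: P') R)
  set S := (x :: P ++ y :: P').toFinset
  have hS : #S ≤ (P.length + 1) + (P'.length + 1) := by
    have := List.toFinset_card_le (x :: P ++ y :: P')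
    rwa [List.length_append, List.length_cons, List.length_cons] at this
  have hcomp : ∀ v, ∃ Q, v ∉ S → Q ∈ R ∧ v ∈ Q := by
    intro v
    obtain ⟨Q, hQ, hv⟩ := List.mem_flatten.1 (h.mem v)
    refine ⟨Q, fun hvS => ⟨?_, hv⟩⟩
    rw [List.mem_toFinset, List.mem_append, not_or] at hvS
    rw [List.mem_cons, List.mem_cons] at hQ
    rcases hQ with rfl | rfl | hQ
    · exact absurd hv hvS.1
    · exact absurd hv hvS.2
    · exact hQ
  choose comp hcomp using hcomp
  set Wx : Finset V := {v | v ∉ S ∧ G.Adj x v ∧ FreeAtHead c (x :: P) (c x v)}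
  set Wy : Finset V := {v | v ∉ S ∧ G.Adj y v ∧ FreeAtHead c (y :: P') (c y v)}
  have hWxc : 2 * Fintype.card V + 3 * k ≤ 3 * (#Wx + #S) := by
    convert le_card_attachable hδ x P S
  have hWyc : 2 * Fintype.card V + 3 * k ≤ 3 * (#Wy + #S) := by
    convert le_card_attachable hδ y P' S
  have hWxS : ∀ v ∈ Wx, comp v ∈ R ∧ v ∈ comp v := fun v hv => hcomp v (mem_filter.1 hv).2.1
  have hWyS : ∀ v ∈ Wy, comp v ∈ R ∧ v ∈ comp v := fun v hv => hcomp v (mem_filter.1 hv).2.1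
  obtain ⟨ux, Ux, hrx, hfx, hqx, hcx, hdx⟩ := h.exists_release_family hc (W := Wx)
    (fun v hv => ⟨List.mem_cons_of_mem _ (hWxS v hv).1, (hWxS v hv).2⟩)
    fun v hv => (mem_filter.1 hv).2.2
  obtain ⟨uy, Uy, hry, hfy, hqy, hcy, hdy⟩ := h'.exists_release_family hc (W := Wy)
    (fun v hv => ⟨List.mem_cons_of_mem _ (hWyS v hv).1, (hWyS v hv).2⟩)
    fun v hv => (mem_filter.1 hv).2.2
  simp only [List.length_cons] at hP hP' hqx hqy
  have hlx : 2 * ((Fintype.card V - 3 * k) / 3) + 2 * (P.length + 1) < #Wx := by omega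
  have hly : 2 * ((Fintype.card V - 3 * k) / 3) + 2 * (P'.length + 1) < #Wy := by omega
  obtain ⟨i, hi, j, hj, hij, h1, h2⟩ := exists_mutual (Wx := Wx) (Wy := Wy) (ux := ux) (uy := uy)
    (Nx := fun i => {z | ¬ (G.Adj (ux i) z ∧ FreeAtHead c (ux i :: Ux i) (c (ux i) z))})
    (Ny := fun j => {z | ¬ (G.Adj (uy j) z ∧ FreeAtHead c (uy j :: Uy j) (c (uy j) z))})
    (comp := comp) (b := (Fintype.card V - 3 * k) / 3)
    (fun i _ => card_not_reachable_le hδ _ _) (fun j _ => card_not_reachable_le hδ _ _)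
    hfx hfy (fun q => (Nat.add_le_add_left (by convert hqx q) _).trans_lt hlx)
    (fun q => (Nat.add_le_add_left (by convert hqy q) _).trans_lt hly) hcx hcy
    (fun i hi i' hi' hne he j _ hN => by
      simp only [mem_filter, mem_univ, true_and, not_not] at hN ⊢
      rw [he]
      have := hdx i hi i' hi' hne he (c (ux i) (uy j))
      rw [he] at this
      exact this.imp (⟨hN.1.symm, ·⟩) (⟨hN.1.symm, ·⟩))
    (fun j hj j' hj' hne he i _ hN => by
      simp only [mem_filter, mem_univ, true_and, not_not] at hN ⊢
      rw [he]
      have := hdy j hj j' hj' hne he (c (uy j) (ux i))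
      rw [he] at this
      exact this.imp (⟨hN.1.symm, ·⟩) (⟨hN.1.symm, ·⟩)) (x :: P)
  simp only [mem_filter, mem_univ, true_and, not_not] at h1 h2
  obtain ⟨t, A, hA, hPA⟩ := hrx i hi
  obtain ⟨t', A', hA', hPA'⟩ := hry j hj
  have hRw : ∀ Q ∈ R, ∀ t, IsPCWalk G c (orient t Q) := fun Q hQ t =>
    (h.walk Q (by simp [hQ])).orient hc t
  exact h.not_glue hc (hWxS i hi).1 (hWyS j hj).1 hij (hA ▸ orient_perm t _)
    (hA' ▸ orient_perm t' _) (hA ▸ hRw _ (hWxS i hi).1 t) (hA' ▸ hRw _ (hWyS j hj).1 t') hPA hPA'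
    h1.1 h1.2 (hc (uy j) (ux i) ▸ h2.2)

end Covers

/-- For every integer `k ≥ 1`, the vertex set of any edge-coloured graph on
`n` vertices with `δ₁^c(G) ≥ 2n/3 + k` can be covered by at most `⌊2n/k⌋` vertex-disjoint
properly coloured paths. -/
theorem stmt6 {V : Type*} [Fintype V] (G : SimpleGraph V) (c : V → V → ℕ)
    (hc : ∀ u v, c u v = c v u) (k : ℕ) (hk : 1 ≤ k)
    (hδ : ∀ (v : V) (a : ℕ),
      (2 * (Fintype.card V : ℝ)) / 3 + k ≤ colourDeg1 G c v a) :
    ∃ S : Finset (List V),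
      S.card ≤ 2 * Fintype.card V / k ∧
      (∀ l ∈ S, l ≠ [] ∧ IsPCPath G c l) ∧
      (∀ l ∈ S, ∀ l' ∈ S, l ≠ l' → ∀ v, v ∈ l → v ∉ l') ∧
      (∀ v : V, ∃ l ∈ S, v ∈ l) := by
  classical
  have hδ' : ∀ v a, 2 * Fintype.card V + 3 * k ≤ 3 * colourDeg1 G c v a := fun v a => by
    have := hδ v a
    have h : (2 * Fintype.card V + 3 * k : ℝ) ≤ 3 * colourDeg1 G c v a := by linarith
    exact_mod_cast h
  obtain ⟨L, hL⟩ := exists_isOptimalCover G c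
  have hlen : L.length * k ≤ 2 * Fintype.card V := by
    rcases isEmpty_or_nonempty V with hV | ⟨⟨v⟩⟩
    · have : L = [] := List.eq_nil_iff_forall_not_mem.2 fun l hl =>
        hL.ne_nil l hl (List.eq_nil_iff_forall_not_mem.2 fun v => hV.elim v)
      simp [this]
    by_contra! hlt
    have hk3 : 3 * k ≤ Fintype.card V := by
      have h1 := hδ' v 0
      have h2 : colourDeg1 G c v 0 ≤ Fintype.card V := by
        rw [colourDeg1, ← Nat.card_eq_fintype_card]
        exact Set.ncard_le_card _
      omega
    obtain ⟨P, P', R, hp, hP, hP'⟩ := hL.exists_two_short hk3 hlt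
    exact (hL.perm hp.symm).not_two_short hc hδ' hk3 hP hP'
  refine ⟨L.toFinset, (List.toFinset_card_le L).trans ((Nat.le_div_iff_mul_le hk).2 hlen),
    fun l hl => ?_, fun l hl l' hl' hne v hv hv' => ?_, fun v => ?_⟩
  · rw [List.mem_toFinset] at hl
    exact ⟨hL.ne_nil l hl, hL.nodup_of_mem hl, hL.walk l hl⟩
  · rw [List.mem_toFinset] at hl hl'
    exact hne (hL.eq_of_mem hl hl' hv hv')
  · simpa using hL.mem v
end

section
/- Let 0 < ε < 2⁻⁹·3⁻¹. There exists n₀ such that for every edge-coloured graph G on n ≥ n₀ vertices with δ₁^c(G) ≥ (2/3 + ε)n, there is a properly coloured cycle C of length at most 2εn/3 with the following absorbing property: for every k ≤ 8ε²n/243 and every collection P₁,...,P_k of vertex-disjoint properly coloured paths in G − V(C), there exists a properly coloured cycle with vertex set exactly V(C) ∪ V(P₁) ∪ ... ∪ V(P_k). -/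
open SimpleGraph

open Finset in
/-- The vertices joined to `v` by an edge whose colour differs from `a`. -/
noncomputable def colourNbrs {V : Type*} [Fintype V] (G : SimpleGraph V) (c : V → V → ℕ)
    (v : V) (a : ℕ) : Finset V := by
  classical exact univ.filter fun w => G.Adj v w ∧ c v w ≠ a

section Walks

variable {V : Type*} {G : SimpleGraph V} {c : V → V → ℕ}

theorem isPCWalk_append_pair (A B : List V) (a b : V) :
    IsPCWalk G c (A ++ a :: b :: B) ↔
      IsPCWalk G c (A ++ [a, b]) ∧ IsPCWalk G c (a :: b :: B) := by
  induction A with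
  | nil => cases B <;> simp +contextual [IsPCWalk]
  | cons x A ih =>
    cases A with
    | nil =>
      simp only [List.nil_append, List.cons_append, IsPCWalk, and_assoc] at ih ⊢
      tauto
    | cons y A => cases A <;> simp_all [IsPCWalk, and_assoc]

/-- Inserting a path in the middle of a four-vertex segment of a properly coloured cycle. -/
theorem IsPCCycle.insert {A B P : List V} {a b d e : V}
    (h : IsPCCycle G c (A ++ a :: b :: d :: e :: B))
    (hP : IsPCWalk G c (a :: b :: (P ++ [d, e]))) (hn : P.Nodup)
    (hd : ∀ v ∈ P, v ∉ A ++ a :: b :: d :: e :: B) :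
    IsPCCycle G c (A ++ a :: b :: (P ++ d :: e :: B)) := by
  obtain ⟨h3, hnd, hw⟩ := h
  have hperm : (A ++ a :: b :: (P ++ d :: e :: B)).Perm (P ++ (A ++ a :: b :: d :: e :: B)) := by
    have h1 : (A ++ a :: b :: (P ++ d :: e :: B)) = ((A ++ [a, b]) ++ P) ++ d :: e :: B := by simp
    have h2 : P ++ (A ++ a :: b :: d :: e :: B) = (P ++ (A ++ [a, b])) ++ d :: e :: B := by simp
    rw [h1, h2]
    exact List.perm_append_comm.append_right _
  refine ⟨by simp; omega, ?_, ?_⟩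
  · rw [hperm.nodup_iff, List.nodup_append']
    exact ⟨hn, hnd, fun v hv hv' => hd v hv hv'⟩
  · have ht : (A ++ a :: b :: (P ++ d :: e :: B)).take 2 =
        (A ++ a :: b :: d :: e :: B).take 2 := by
      rcases A with _ | ⟨x, _ | ⟨y, A⟩⟩ <;> simp
    rw [ht]
    generalize (A ++ a :: b :: d :: e :: B).take 2 = T at hw ⊢
    have hw' : IsPCWalk G c (A ++ a :: b :: (d :: e :: (B ++ T))) := by simpa using hw
    rw [isPCWalk_append_pair] at hw'
    have h2 := (isPCWalk_append_pair [a, b] (B ++ T) d e).1 hw'.2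
    have : IsPCWalk G c (A ++ a :: b :: (P ++ d :: e :: (B ++ T))) := by
      rw [isPCWalk_append_pair]
      exact ⟨hw'.1, (isPCWalk_append_pair (a :: b :: P) (B ++ T) d e).2 ⟨hP, h2.2⟩⟩
    simpa using this

end Walks

section Quads

variable {V : Type*} (G : SimpleGraph V) (c : V → V → ℕ)

/-- The tuple `(b, d, a, e)` stands for the path `a b d e`; these are its vertices. -/
def quadVerts (q : V × V × V × V) : List V := [q.2.2.1, q.1, q.2.1, q.2.2.2]

/-- A family of vertex-disjoint properly coloured paths on four vertices. -/
def IsQuadFamily (L : List (V × V × V × V)) : Prop :=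
  (L.flatMap quadVerts).Nodup ∧ ∀ q ∈ L, IsPCWalk G c (quadVerts q)

/-- The path `a b d e` coded by `q` can absorb, between `b` and `d`, any properly coloured path
that starts with `x, x'` and ends with `y', y`, where `t = (x, x', y, y')`; for `x = y` it can
absorb the single vertex `x`. -/
def QuadAbsorbs (t q : V × V × V × V) : Prop :=
  G.Adj q.1 t.1 ∧ G.Adj t.2.2.1 q.2.1 ∧
  c q.2.2.1 q.1 ≠ c q.1 t.1 ∧ c t.2.2.1 q.2.1 ≠ c q.2.1 q.2.2.2 ∧
  c q.1 t.1 ≠ c t.1 t.2.1 ∧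
  (t.1 = t.2.2.1 → c q.1 t.1 ≠ c t.1 q.2.1) ∧
  (t.1 ≠ t.2.2.1 → c t.2.2.1 q.2.1 ≠ c t.2.2.1 t.2.2.2)

/-- The segment `a b R d e p r` of the cycle, `R` being the path absorbed by the quad. -/
def quadBlock (R : V × V × V × V → List V) (i : (V × V × V × V) × V × V) : List V :=
  i.1.2.2.1 :: i.1.1 :: (R i.1 ++ [i.1.2.1, i.1.2.2.2, i.2.1, i.2.2])

variable {G c}

theorem IsQuadFamily.nodup {L : List (V × V × V × V)} (h : IsQuadFamily G c L) : L.Nodup := by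
  have := (List.nodup_flatMap.1 h.1).2
  refine this.imp ?_
  rintro q _ hd rfl
  exact hd (a := q.1) (by simp [quadVerts]) (by simp [quadVerts])

theorem exists_quadAbsorbs (hc : ∀ u v, c u v = c v u) {P : List V} (hP : IsPCPath G c P) (hne : P ≠ []) :
    ∃ t, ∀ q, IsPCWalk G c (quadVerts q) → QuadAbsorbs G c t q →
      IsPCWalk G c (q.2.2.1 :: q.1 :: (P ++ [q.2.1, q.2.2.2])) := by
  obtain ⟨hn, hw⟩ := hP
  rcases P with _ | ⟨x, _ | ⟨x', P⟩⟩
  · exact absurd rfl hne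
  · refine ⟨(x, x, x, x), ?_⟩
    rintro ⟨b, d, a, e⟩ hq ⟨h1, h2, h3, h4, h5, h6, -⟩
    simp_all [IsPCWalk, quadVerts]
  · obtain ⟨Q, y', y, hQ⟩ : ∃ Q y' y, x :: x' :: P = Q ++ [y', y] := by
      obtain ⟨Q, y, h⟩ := (List.eq_nil_or_concat' (x' :: P)).resolve_left (by simp)
      rcases List.eq_nil_or_concat' Q with rfl | ⟨Q', y', rfl⟩
      · exact ⟨[], x, y, by simpa using h⟩
      · exact ⟨x :: Q', y', y, by simp [h]⟩
    have hxy : x ≠ y := by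
      have : y ∈ x' :: P := by
        have := congrArg List.getLast? hQ
        simp only [List.getLast?_cons_cons, List.getLast?_append] at this
        exact List.mem_of_getLast? (by simpa using this)
      rintro rfl
      exact (List.nodup_cons.1 hn).1 this
    refine ⟨(x, x', y, y'), ?_⟩
    rintro ⟨b, d, a, e⟩ hq ⟨h1, h2, h3, h4, h5, -, h7⟩
    have hlast : IsPCWalk G c ((x :: x' :: P) ++ [d, e]) := by
      rw [hQ] at hw ⊢
      have h := ((isPCWalk_append_pair Q [] y' y).1 hw).2
      have : IsPCWalk G c (Q ++ y' :: y :: [d, e]) := by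
        refine (isPCWalk_append_pair Q [d, e] y' y).2 ⟨hw, ?_⟩
        simp only [IsPCWalk, quadVerts] at h hq h2 h4 h7 ⊢
        refine ⟨h, ?_, h2, h4, hq.2.2.2.2⟩
        rw [hc y' y]
        exact (h7 hxy).symm
      simpa using this
    simp only [IsPCWalk, quadVerts, List.cons_append] at hq h1 h3 h5 hlast ⊢
    exact ⟨hq.1, h3, h1, h5, hlast⟩

end Quads

section Counting

open Finset

variable {V : Type*} [Fintype V] {G : SimpleGraph V} {c : V → V → ℕ}

theorem mem_colourNbrs {v w : V} {a : ℕ} :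
    w ∈ colourNbrs G c v a ↔ G.Adj v w ∧ c v w ≠ a := by
  classical simp [colourNbrs]

theorem card_colourNbrs (v : V) (a : ℕ) : #(colourNbrs G c v a) = colourDeg1 G c v a := by
  rw [colourDeg1, ← Set.ncard_coe_finset]
  congr 1
  ext w
  simp [mem_colourNbrs]

theorem le_card_inter_sdiff [DecidableEq V] {ε : ℝ} (hε : 0 ≤ ε)
    (hd : ∀ v a, (2 / 3 + ε) * (Fintype.card V : ℝ) ≤ colourDeg1 G c v a)
    (u v : V) (a b : ℕ) {U : Finset V} (hU : (#U : ℝ) ≤ ε * Fintype.card V) :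
    (Fintype.card V : ℝ) / 3 ≤ #((colourNbrs G c u a ∩ colourNbrs G c v b) \ U) := by
  have h1 := hd u a
  have h2 := hd v b
  rw [← card_colourNbrs] at h1 h2
  have h3 := card_union_add_card_inter (colourNbrs G c u a) (colourNbrs G c v b)
  have h4 := card_le_univ (colourNbrs G c u a ∪ colourNbrs G c v b)
  have h5 := card_le_card_sdiff_add_card (t := U) (s := colourNbrs G c u a ∩ colourNbrs G c v b)
  rify at h3 h4 h5
  have : 0 ≤ ε * (Fintype.card V : ℝ) := by positivity
  linarith

/-- Any two edges can be joined by a properly coloured path with two inner vertices. -/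
theorem exists_connector {ε : ℝ} (hε : 0 < ε)
    (hd : ∀ v a, (2 / 3 + ε) * (Fintype.card V : ℝ) ≤ colourDeg1 G c v a)
    (hc : ∀ u v, c u v = c v u) {U : Finset V} (hU : (#U : ℝ) ≤ ε * Fintype.card V)
    (x y : V) (a b : ℕ) :
    ∃ p r, p ∉ U ∧ r ∉ U ∧ G.Adj x p ∧ G.Adj p r ∧ G.Adj r y ∧
      a ≠ c x p ∧ c x p ≠ c p r ∧ c p r ≠ c r y ∧ c r y ≠ b := by
  classical
  by_contra! hno
  have hn : 0 < (Fintype.card V : ℝ) := by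
    have : 0 < Fintype.card V := Fintype.card_pos_iff.2 ⟨x⟩
    exact_mod_cast this
  set n : ℝ := (Fintype.card V : ℝ) with hn_def
  have hsd : ∀ v a, 2 / 3 * n ≤ #(colourNbrs G c v a \ U) := by
    intro v a
    have h1 := hd v a
    rw [← card_colourNbrs] at h1
    have h5 := card_le_card_sdiff_add_card (t := U) (s := colourNbrs G c v a)
    rify at h5
    linarith
  have hbad : ∀ v a (Y : Finset V), (#(Y.filter fun w => w ∉ colourNbrs G c v a) : ℝ) ≤
      (1 / 3 - ε) * n := by
    intro v a Y
    have h1 := hd v a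
    rw [← card_colourNbrs] at h1
    have h2 : #(Y.filter fun w => w ∉ colourNbrs G c v a) ≤ #(colourNbrs G c v a)ᶜ :=
      card_le_card fun w hw => by simpa using (mem_filter.1 hw).2
    have h3 := card_add_card_compl (colourNbrs G c v a)
    rify at h2 h3
    linarith
  set X := colourNbrs G c x a \ U with hX
  set Y := colourNbrs G c y b \ U with hY
  have hcover : ∀ p ∈ X, ∀ r ∈ Y, (1 : ℝ) ≤
      (if r ∉ colourNbrs G c p (c x p) then 1 else 0) +
        (if p ∉ colourNbrs G c r (c r y) then 1 else 0) := by
    intro p hp r hr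
    by_cases h1 : r ∈ colourNbrs G c p (c x p)
    · by_cases h2 : p ∈ colourNbrs G c r (c r y)
      · rw [mem_colourNbrs] at h1 h2
        rw [hX, mem_sdiff, mem_colourNbrs] at hp
        rw [hY, mem_sdiff, mem_colourNbrs] at hr
        refine absurd (hno p r hp.2 hr.2 hp.1.1 h1.1 hr.1.1.symm (Ne.symm hp.1.2) (Ne.symm h1.2)
          (by rw [hc p r]; exact h2.2)) ?_
        rw [hc r y]
        exact hr.1.2
      · simp [h1, h2]
    · simp only [h1, not_false_eq_true, if_true]
      split_ifs <;> norm_num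
  have hsum : (#X * #Y : ℝ) ≤ #X * ((1 / 3 - ε) * n) + #Y * ((1 / 3 - ε) * n) := by
    calc (#X * #Y : ℝ) = ∑ p ∈ X, ∑ r ∈ Y, (1 : ℝ) := by simp
      _ ≤ ∑ p ∈ X, ∑ r ∈ Y, ((if r ∉ colourNbrs G c p (c x p) then 1 else 0) +
            (if p ∉ colourNbrs G c r (c r y) then 1 else 0)) :=
          sum_le_sum fun p hp => sum_le_sum fun r hr => hcover p hp r hr
      _ = ∑ p ∈ X, (#(Y.filter fun r => r ∉ colourNbrs G c p (c x p)) : ℝ) +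
            ∑ r ∈ Y, (#(X.filter fun p => p ∉ colourNbrs G c r (c r y)) : ℝ) := by
          simp only [sum_add_distrib]
          congr 1
          · simp only [sum_boole]
          · rw [sum_comm]
            simp only [sum_boole]
      _ ≤ ∑ p ∈ X, (1 / 3 - ε) * n + ∑ r ∈ Y, (1 / 3 - ε) * n :=
          add_le_add (sum_le_sum fun p _ => hbad _ _ _) (sum_le_sum fun r _ => hbad _ _ _)
      _ = _ := by simp
  have hx : 2 / 3 * n ≤ #X := hsd x a
  have hy : 2 / 3 * n ≤ #Y := hsd y b
  have hx0 : (0 : ℝ) < #X := by linarith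
  have hy0 : (0 : ℝ) < #Y := by linarith
  nlinarith [mul_le_mul_of_nonneg_right hx hy0.le, mul_le_mul_of_nonneg_right hy hx0.le,
    mul_pos (mul_pos hε hn) hx0, mul_pos (mul_pos hε hn) hy0]

theorem mul_le_card_of_fibres {α β : Type*} (S : Finset (α × β)) (A : Finset α)
    (B : α → Finset β) {r s : ℝ} (hs : 0 ≤ s) (hS : ∀ x ∈ A, ∀ y ∈ B x, (x, y) ∈ S)
    (hA : r ≤ #A) (hB : ∀ x ∈ A, s ≤ #(B x)) : r * s ≤ #S := by
  calc r * s ≤ #A * s := by gcongr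
    _ = ∑ x ∈ A, s := by simp
    _ ≤ ∑ x ∈ A, (#(B x) : ℝ) := sum_le_sum hB
    _ = #(A.sigma B) := by simp [card_sigma]
    _ ≤ #S := by
      gcongr
      refine card_le_card_of_injOn (fun p => (p.1, p.2)) ?_ ?_
      · rintro ⟨x, y⟩ h
        simp only [coe_sigma, Set.mem_sigma_iff, mem_coe] at h
        exact hS x h.1 y h.2
      · rintro ⟨x, y⟩ - ⟨x', y'⟩ - h
        simpa using h

open Classical in
/-- Every absorption problem is solved by a positive proportion of all four-tuples, even if
few vertices are forbidden. -/
theorem le_card_quadAbsorbs {ε : ℝ} (hε : 0 < ε)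
    (hd : ∀ v a, (2 / 3 + ε) * (Fintype.card V : ℝ) ≤ colourDeg1 G c v a)
    (hc : ∀ u v, c u v = c v u) {L : List (V × V × V × V)} (hL : IsQuadFamily G c L)
    (hlen : 4 * (L.length : ℝ) + 2 ≤ ε * Fintype.card V) (t : V × V × V × V) :
    1 / 81 * (Fintype.card (V × V × V × V) : ℝ) ≤
      #(univ.filter fun q => IsQuadFamily G c (q :: L) ∧ QuadAbsorbs G c t q) := by
  obtain ⟨x, x', y, y'⟩ := t
  set n : ℝ := (Fintype.card V : ℝ) with hn
  have hn0 : 0 ≤ n := by positivity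
  set U : Finset V := (L.flatMap quadVerts).toFinset with hUdef
  have hU : (#U : ℝ) + 2 ≤ ε * n := by
    refine le_trans ?_ hlen
    gcongr
    have : #U ≤ 4 * L.length := by
      refine (List.toFinset_card_le _).trans (le_of_eq ?_)
      simp [List.length_flatMap, quadVerts, mul_comm]
    exact_mod_cast this
  have hU0 : (#U : ℝ) ≤ ε * n := by linarith
  have hU1 : ∀ z, (#(insert z U) : ℝ) ≤ ε * n := fun z => by
    have := card_insert_le z U
    rify at this
    linarith
  have hU2 : ∀ z w, (#(insert w (insert z U)) : ℝ) ≤ ε * n := fun z w => by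
    have := card_insert_le z U
    have := card_insert_le w (insert z U)
    rify at *
    linarith
  have hcard : 1 / 81 * (Fintype.card (V × V × V × V) : ℝ) = n / 3 * (n / 3 * (n / 3 * (n / 3))) := by
    simp only [Fintype.card_prod, Nat.cast_mul, ← hn]
    ring
  rw [hcard]
  set z3 : V → ℕ := fun b => if x = y then c b x else c y y' with hz3
  refine mul_le_card_of_fibres _ ((colourNbrs G c x (c x x') ∩ colourNbrs G c x (c x x')) \ U)
    (fun b => univ.filter fun p => (b, p) ∈
      univ.filter fun q => IsQuadFamily G c (q :: L) ∧ QuadAbsorbs G c (x, x', y, y') q)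
    (by positivity) (fun b hb p hp => (mem_filter.1 hp).2)
    (le_card_inter_sdiff hε.le hd _ _ _ _ hU0) fun b hb => ?_
  refine mul_le_card_of_fibres _ ((colourNbrs G c b 0 ∩ colourNbrs G c y (z3 b)) \ U)
    (fun d => univ.filter fun p => (d, p) ∈ univ.filter fun p' => (b, p') ∈
      univ.filter fun q => IsQuadFamily G c (q :: L) ∧ QuadAbsorbs G c (x, x', y, y') q)
    (by positivity) (fun d hd p hp => (mem_filter.1 hp).2)
    (le_card_inter_sdiff hε.le hd _ _ _ _ hU0) fun d hdd => ?_
  refine mul_le_card_of_fibres _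
    ((colourNbrs G c b (c b d) ∩ colourNbrs G c b (c b x)) \ insert d U)
    (fun a => (colourNbrs G c d (c b d) ∩ colourNbrs G c d (c y d)) \ insert a (insert b U))
    (by positivity) (fun a ha e he => ?_)
    (le_card_inter_sdiff hε.le hd _ _ _ _ (hU1 _))
    (fun a ha => le_card_inter_sdiff hε.le hd _ _ _ _ (hU2 _ _))
  simp only [mem_sdiff, mem_inter, mem_colourNbrs, mem_insert, not_or] at hb hdd ha he
  obtain ⟨⟨⟨hb1, hb2⟩, -⟩, hbU⟩ := hb
  obtain ⟨⟨⟨hd1, -⟩, hd2, hd3⟩, hdU⟩ := hdd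
  obtain ⟨⟨⟨ha1, ha2⟩, -, ha3⟩, had, haU⟩ := ha
  obtain ⟨⟨⟨he1, he2⟩, -, he3⟩, hea, heb, heU⟩ := he
  simp only [mem_filter, mem_univ, true_and]
  refine ⟨⟨?_, ?_⟩, hb1.symm, hd2, ?_, ?_, ?_, ?_, ?_⟩
  · simp only [hUdef, List.mem_toFinset] at hbU hdU haU heU
    rw [List.flatMap_cons, List.nodup_append']
    refine ⟨?_, hL.1, ?_⟩
    · simp only [quadVerts, List.nodup_cons, List.mem_cons, List.not_mem_nil, or_false, not_or,
        not_false_eq_true, List.nodup_nil, and_true]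
      exact ⟨⟨ha1.ne', had, Ne.symm hea⟩, ⟨hd1.ne, Ne.symm heb⟩, he1.ne⟩
    · intro v hv hv'
      simp only [quadVerts, List.mem_cons, List.not_mem_nil, or_false] at hv
      rcases hv with rfl | rfl | rfl | rfl <;> contradiction
  · intro q hq
    rcases List.mem_cons.1 hq with rfl | hq
    · simp only [quadVerts, IsPCWalk]
      refine ⟨ha1.symm, ?_, hd1, Ne.symm he2, he1⟩
      rw [hc a b]
      exact ha2
    · exact hL.2 q hq
  · simp only
    rw [hc a b]
    exact ha3
  · exact Ne.symm he3
  · simp only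
    rw [hc b x]
    exact hb2
  · intro hxy
    simp only [hz3] at hxy hd3 ⊢
    subst hxy
    simpa using Ne.symm hd3
  · intro hxy
    simp only [hz3] at hxy hd3 ⊢
    simpa [hxy] using hd3

end Counting

section Selection

open Finset

open Classical in
/-- Greedy selection: if after every admissible choice of fewer than `m` elements, every target
is hit by a positive proportion of all elements that may be chosen next, then some admissible
choice of `m` elements hits every target often. -/
theorem exists_list_hitting {T Ω : Type*} [Fintype T] [Fintype Ω] [Nonempty T] [Nonempty Ω]
    (Valid : List Ω → Prop) (hit : T → Ω → Prop) {γ : ℝ} (hγ0 : 0 < γ) (hγ1 : γ ≤ 1)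
    (h0 : Valid []) (m : ℕ)
    (h : ∀ L, Valid L → L.length < m → ∀ t,
      γ * (Fintype.card Ω : ℝ) ≤ #(univ.filter fun ω => Valid (ω :: L) ∧ hit t ω)) :
    ∃ L, Valid L ∧ L.length = m ∧
      ∑ t, (1 / 2 : ℝ) ^ (L.countP fun ω => hit t ω) ≤ Fintype.card T * (1 - γ / 2) ^ m := by
  suffices H : ∀ j ≤ m, ∃ L, Valid L ∧ L.length = j ∧
      ∑ t, (1 / 2 : ℝ) ^ (L.countP fun ω => hit t ω) ≤ Fintype.card T * (1 - γ / 2) ^ j from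
    H m le_rfl
  intro j
  induction j with
  | zero => exact fun _ => ⟨[], h0, rfl, by simp⟩
  | succ j ih =>
    intro hj
    obtain ⟨L, hL, hlen, hsum⟩ := ih (by omega)
    have hL' := h L hL (by omega)
    set ok := univ.filter fun ω => Valid (ω :: L) with hok
    have hsub : ∀ t, (univ.filter fun ω => Valid (ω :: L) ∧ hit t ω) =
        ok.filter fun ω => hit t ω := fun t => by rw [hok, filter_filter]
    have hne : ok.Nonempty := by
      obtain ⟨t⟩ := ‹Nonempty T›
      have h1 := hL' t
      have h2 : 0 < γ * (Fintype.card Ω : ℝ) := by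
        have : 0 < Fintype.card Ω := Fintype.card_pos
        positivity
      have h3 := h2.trans_le h1
      rw [hsub] at h3
      exact (card_pos.1 (by exact_mod_cast h3)).mono (filter_subset _ _)
    have hkey : ∀ t, ∑ ω ∈ ok, (1 / 2 : ℝ) ^ ((ω :: L).countP fun ω => hit t ω) ≤
        (1 / 2 : ℝ) ^ (L.countP fun ω => hit t ω) * ((1 - γ / 2) * #ok) := by
      intro t
      have h1 : ∀ ω, (1 / 2 : ℝ) ^ ((ω :: L).countP fun ω => hit t ω) =
          (1 / 2 : ℝ) ^ (L.countP fun ω => hit t ω) * (1 - 1 / 2 * if hit t ω then 1 else 0) := by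
        intro ω
        by_cases hω : hit t ω <;> simp [hω, pow_succ]
        norm_num
      simp only [h1]
      rw [← mul_sum]
      gcongr
      rw [sum_sub_distrib, ← mul_sum, sum_boole]
      have h2 := hL' t
      rw [hsub] at h2
      have h3 : (#ok : ℝ) ≤ Fintype.card Ω := by exact_mod_cast card_le_univ ok
      have h4 : γ * (#ok : ℝ) ≤ γ * Fintype.card Ω := by gcongr
      simp only [sum_const, nsmul_eq_mul, mul_one]
      linarith
    have htot : ∑ ω ∈ ok, ∑ t, (1 / 2 : ℝ) ^ ((ω :: L).countP fun ω => hit t ω) ≤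
        ∑ _ω ∈ ok, Fintype.card T * (1 - γ / 2) ^ (j + 1) := by
      rw [sum_comm]
      calc _ ≤ ∑ t, (1 / 2 : ℝ) ^ (L.countP fun ω => hit t ω) * ((1 - γ / 2) * #ok) :=
            sum_le_sum fun t _ => hkey t
        _ = (∑ t, (1 / 2 : ℝ) ^ (L.countP fun ω => hit t ω)) * ((1 - γ / 2) * #ok) := by
            rw [sum_mul]
        _ ≤ (Fintype.card T * (1 - γ / 2) ^ j) * ((1 - γ / 2) * #ok) := by
            have : 0 ≤ 1 - γ / 2 := by linarith
            gcongr
        _ = _ := by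
            rw [sum_const, nsmul_eq_mul]
            ring
    obtain ⟨ω, hω, hle⟩ := exists_le_of_sum_le hne htot
    exact ⟨ω :: L, (mem_filter.1 hω).2, by simp [hlen], hle⟩

end Selection

section Assembly

open Finset

theorem length_flatMap_quadBlock {V : Type*} (I : List ((V × V × V × V) × V × V)) :
    (I.flatMap (quadBlock fun _ => [])).length = 6 * I.length := by
  simp [List.length_flatMap, quadBlock, mul_comm]

open Classical in
/-- A properly coloured cycle through enough quads absorbs any few disjoint paths. -/
theorem exists_absorbing_cycle {V : Type*} {G : SimpleGraph V} {c : V → V → ℕ}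
    (hc : ∀ u v, c u v = c v u)
    {I : List ((V × V × V × V) × V × V)} (hI : (I.map Prod.fst).Nodup)
    (hq : ∀ q ∈ I.map Prod.fst, IsPCWalk G c (quadVerts q))
    (hC : IsPCCycle G c (I.flatMap (quadBlock fun _ => [])))
    {k : ℕ} {P : Fin k → List V} (hP : ∀ i, P i ≠ [] ∧ IsPCPath G c (P i))
    (hPC : ∀ i, ∀ v ∈ P i, v ∉ I.flatMap (quadBlock fun _ => []))
    (hPP : ∀ i j, i ≠ j → ∀ v ∈ P i, v ∉ P j)
    (hits : ∀ t, k ≤ (I.map Prod.fst).countP fun q => QuadAbsorbs G c t q) :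
    ∃ C' : List V, IsPCCycle G c C' ∧
      ∀ v, v ∈ C' ↔ (v ∈ I.flatMap (quadBlock fun _ => []) ∨ ∃ i, v ∈ P i) := by
  suffices H : ∀ s : Finset (Fin k), ∃ (R : V × V × V × V → List V)
      (S : Finset (V × V × V × V)), #S ≤ #s ∧ (∀ q ∉ S, R q = []) ∧
      IsPCCycle G c (I.flatMap (quadBlock R)) ∧
      ∀ v, v ∈ I.flatMap (quadBlock R) ↔
        (v ∈ I.flatMap (quadBlock fun _ => []) ∨ ∃ i ∈ s, v ∈ P i) by
    obtain ⟨R, S, -, -, hR, hv⟩ := H univ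
    exact ⟨_, hR, by simpa using hv⟩
  intro s
  induction s using Finset.induction_on with
  | empty => exact ⟨fun _ => [], ∅, le_rfl, fun _ _ => rfl, hC, by simp⟩
  | insert i s his ih =>
    obtain ⟨R, S, hS, hRS, hR, hv⟩ := ih
    obtain ⟨t, ht⟩ := exists_quadAbsorbs hc (hP i).2 (hP i).1
    obtain ⟨q, hqI, hqt, hqS⟩ : ∃ q ∈ I.map Prod.fst, QuadAbsorbs G c t q ∧ q ∉ S := by
      by_contra! hno
      have h1 : #(((I.map Prod.fst).filter fun q => QuadAbsorbs G c t q).toFinset) ≤ #S := by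
        refine card_le_card fun q hq => ?_
        simp only [List.mem_toFinset, List.mem_filter, decide_eq_true_eq] at hq
        exact hno q hq.1 hq.2
      rw [List.toFinset_card_of_nodup (hI.filter _), ← List.countP_eq_length_filter] at h1
      have h2 := hits t
      have h3 := card_le_univ (insert i s)
      rw [card_insert_of_notMem his, Fintype.card_fin] at h3
      omega
    have hw := ht q (hq q hqI) hqt
    obtain ⟨⟨q', p, r⟩, hmem, rfl⟩ := List.mem_map.1 hqI
    obtain ⟨I₁, I₂, rfl⟩ := List.append_of_mem hmem
    simp only [List.map_append, List.map_cons] at hI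
    have hI1 : q' ∉ I₁.map Prod.fst ∧ q' ∉ I₂.map Prod.fst := by
      rw [List.nodup_middle, List.nodup_cons] at hI
      simpa using hI.1
    have hcongr : ∀ J : List ((V × V × V × V) × V × V), q' ∉ J.map Prod.fst →
        J.flatMap (quadBlock (Function.update R q' (P i))) = J.flatMap (quadBlock R) := by
      intro J hJ
      refine List.flatMap_congr fun j hj => ?_
      have : j.1 ≠ q' := fun h => hJ (h ▸ List.mem_map_of_mem hj)
      simp [quadBlock, Function.update_of_ne this]
    obtain ⟨b, d, a, e⟩ := q'
    have hold : (I₁ ++ ((b, d, a, e), p, r) :: I₂).flatMap (quadBlock R) =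
        I₁.flatMap (quadBlock R) ++ a :: b :: d :: e :: (p :: r :: I₂.flatMap (quadBlock R)) := by
      simp [quadBlock, hRS _ hqS]
    have hnew : (I₁ ++ ((b, d, a, e), p, r) :: I₂).flatMap
          (quadBlock (Function.update R (b, d, a, e) (P i))) =
        I₁.flatMap (quadBlock R) ++
          a :: b :: (P i ++ d :: e :: (p :: r :: I₂.flatMap (quadBlock R))) := by
      rw [List.flatMap_append, List.flatMap_cons, hcongr _ hI1.1, hcongr _ hI1.2]
      simp [quadBlock]
    have hdisj : ∀ v ∈ P i,
        v ∉ (I₁ ++ ((b, d, a, e), p, r) :: I₂).flatMap (quadBlock R) := by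
      intro v hvi hvR
      rcases (hv v).1 hvR with h | ⟨j, hj, hvj⟩
      · exact hPC i v hvi h
      · exact hPP i j (fun h => his (h ▸ hj)) v hvi hvj
    refine ⟨Function.update R (b, d, a, e) (P i), insert (b, d, a, e) S, ?_, ?_, ?_, ?_⟩
    · rw [card_insert_of_notMem his]
      exact (card_insert_le _ _).trans (by omega)
    · intro q hq
      rw [mem_insert, not_or] at hq
      rw [Function.update_of_ne hq.1]
      exact hRS q hq.2
    · rw [hnew]
      rw [hold] at hR hdisj
      exact hR.insert hw (hP i).2.1 hdisj
    · intro v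
      have h1 : v ∈ (I₁ ++ ((b, d, a, e), p, r) :: I₂).flatMap
          (quadBlock (Function.update R (b, d, a, e) (P i))) ↔
          v ∈ (I₁ ++ ((b, d, a, e), p, r) :: I₂).flatMap (quadBlock R) ∨ v ∈ P i := by
        rw [hnew, hold]
        simp only [List.mem_append, List.mem_cons]
        tauto
      rw [h1, hv]
      simp only [mem_insert, exists_eq_or_imp]
      rw [or_assoc, or_comm (b := v ∈ P i)]

variable {V : Type*} [Fintype V] {G : SimpleGraph V} {c : V → V → ℕ}

/-- A quad family can be linked up, through new vertices, to a properly coloured path ending in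
a prescribed edge. -/
theorem exists_linked_blocks {ε : ℝ} (hε : 0 < ε)
    (hd : ∀ v a, (2 / 3 + ε) * (Fintype.card V : ℝ) ≤ colourDeg1 G c v a)
    (hc : ∀ u v, c u v = c v u) {U : Finset V} {s t : V} (hst : G.Adj s t)
    (L : List (V × V × V × V)) (hL : IsQuadFamily G c L)
    (hU : (#U : ℝ) + 6 * L.length ≤ ε * Fintype.card V)
    (hLU : ∀ v ∈ L.flatMap quadVerts, v ∈ U) :
    ∃ I : List ((V × V × V × V) × V × V), I.map Prod.fst = L ∧
      (I.flatMap (quadBlock fun _ => [])).Nodup ∧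
      IsPCWalk G c (I.flatMap (quadBlock fun _ => []) ++ [s, t]) ∧
      ∀ v ∈ I.flatMap (quadBlock fun _ => []), v ∈ L.flatMap quadVerts ∨ v ∉ U := by
  classical
  induction L with
  | nil => exact ⟨[], by simp [IsPCWalk, hst]⟩
  | cons q L ih =>
    obtain ⟨b, d, a, e⟩ := q
    have hnd := hL.1
    rw [List.flatMap_cons, List.nodup_append'] at hnd
    obtain ⟨hq, hLn, hdisj⟩ := hnd
    obtain ⟨I, hIL, hIn, hIw, hIU⟩ := ih ⟨hLn, fun q hq => hL.2 q (List.mem_cons_of_mem _ hq)⟩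
      (by simp only [List.length_cons, Nat.cast_add, Nat.cast_one] at hU; linarith)
      (fun v hv => hLU v (by rw [List.flatMap_cons]; exact List.mem_append_right _ hv))
    have hlen : I.length = L.length := by rw [← hIL, List.length_map]
    obtain ⟨s', t', rest, hhead⟩ : ∃ s' t' rest,
        I.flatMap (quadBlock fun _ => []) ++ [s, t] = s' :: t' :: rest := by
      rcases I with _ | ⟨i, I⟩
      · exact ⟨s, t, [], by simp⟩
      · simp [quadBlock]
    set W := I.flatMap (quadBlock fun _ => []) with hW
    have hUW : (#(U ∪ W.toFinset) : ℝ) ≤ ε * Fintype.card V := by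
      have h1 : #(U ∪ W.toFinset) ≤ #U + 6 * L.length := by
        refine (card_union_le _ _).trans ?_
        gcongr
        rw [← hlen, ← length_flatMap_quadBlock]
        exact List.toFinset_card_le _
      rify at h1
      simp only [List.length_cons, Nat.cast_add, Nat.cast_one] at hU
      linarith
    obtain ⟨p, r, hp, hr, h1, h2, h3, h4, h5, h6, h7⟩ :=
      exists_connector hε hd hc hUW e s' (c d e) (c s' t')
    simp only [mem_union, List.mem_toFinset, not_or] at hp hr
    have hqw := hL.2 _ (List.mem_cons_self ..)
    have hqU : ∀ v ∈ quadVerts (b, d, a, e), v ∈ U ∧ v ∉ W := by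
      intro v hv
      have hvU : v ∈ U := hLU v (by rw [List.flatMap_cons]; exact List.mem_append_left _ hv)
      refine ⟨hvU, fun hvW => ?_⟩
      rcases hIU v hvW with h | h
      · exact hdisj hv h
      · exact h hvU
    have hblock : (((b, d, a, e), p, r) :: I).flatMap (quadBlock fun _ => []) =
        quadVerts (b, d, a, e) ++ (p :: r :: W) := by
      simp [quadBlock, quadVerts, hW]
    refine ⟨((b, d, a, e), p, r) :: I, by simp [hIL], ?_, ?_, ?_⟩
    · rw [hblock, List.nodup_append']
      refine ⟨hq, ?_, ?_⟩
      · simp only [List.nodup_cons, List.mem_cons, not_or]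
        exact ⟨⟨h2.ne, hp.2⟩, hr.2, hIn⟩
      · intro v hv hv'
        obtain ⟨hvU, hvW⟩ := hqU v hv
        simp only [List.mem_cons] at hv'
        rcases hv' with rfl | rfl | h
        · exact hp.1 hvU
        · exact hr.1 hvU
        · exact hvW h
    · rw [hblock, List.append_assoc, List.cons_append, List.cons_append, hhead]
      rw [hhead] at hIw
      simp only [quadVerts, IsPCWalk, List.cons_append, List.nil_append] at hqw ⊢
      exact ⟨hqw.1, hqw.2.1, hqw.2.2.1, hqw.2.2.2.1, hqw.2.2.2.2, h4, h1, h5, h2, h6, h3, h7, hIw⟩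
    · intro v hv
      rw [hblock, List.mem_append, List.mem_cons, List.mem_cons] at hv
      rw [List.flatMap_cons, List.mem_append]
      rcases hv with h | rfl | rfl | h
      · exact .inl (.inl h)
      · exact .inr hp.1
      · exact .inr hr.1
      · exact (hIU v h).imp_left .inr

end Assembly

/-- Exponential decay in `n` beats the fourth power. -/
theorem exists_threshold {ε : ℝ} (hε0 : 0 < ε) (hε1 : ε < 1 / (512 * 3)) :
    ∃ n₀ : ℕ, ∀ n : ℕ, n₀ ≤ n → 36 ≤ ε * n ∧ ∀ k h : ℕ, h < k →
      (k : ℝ) ≤ 8 * ε ^ 2 * n / 243 →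
      (n : ℝ) ^ 4 * (1 - 1 / 81 / 2) ^ ⌊ε * n / 18⌋₊ < (1 / 2) ^ h := by
  have hlim : Filter.Tendsto (fun n : ℕ => (ε / 4000 * n) ^ 4 * Real.exp (-(ε / 4000 * n)))
      Filter.atTop (nhds 0) :=
    (Real.tendsto_pow_mul_exp_neg_atTop_nhds_zero 4).comp
      (tendsto_natCast_atTop_atTop.const_mul_atTop (by positivity))
  have hev : ∀ᶠ n : ℕ in Filter.atTop, 36 ≤ ε * n :=
    (tendsto_natCast_atTop_atTop.const_mul_atTop hε0).eventually_ge_atTop 36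
  obtain ⟨n₀, hn₀⟩ := Filter.eventually_atTop.1
    ((hlim.eventually (gt_mem_nhds (show (0 : ℝ) < (ε / 4000) ^ 4 * Real.exp (-1) by positivity))).and
      hev)
  refine ⟨n₀, fun n hn => ?_⟩
  obtain ⟨h1, h36⟩ := hn₀ n hn
  refine ⟨h36, fun k h hhk hk => ?_⟩
  have h2 : (n : ℝ) ^ 4 * Real.exp (-(ε / 4000 * n)) < Real.exp (-1) := by
    rw [mul_pow, mul_assoc] at h1
    exact lt_of_mul_lt_mul_left h1 (by positivity)
  have hm : ε * n / 18 - 1 ≤ (⌊ε * n / 18⌋₊ : ℝ) := (Nat.sub_one_lt_floor _).le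
  set m := ⌊ε * n / 18⌋₊
  have hpow : (1 - 1 / 81 / 2 : ℝ) ^ m ≤ Real.exp (-(m / 162)) := by
    have h3 : (1 - 1 / 81 / 2 : ℝ) ≤ Real.exp (-(1 / 162)) := by
      have := Real.add_one_le_exp (-(1 / 162) : ℝ)
      linarith
    calc _ ≤ Real.exp (-(1 / 162)) ^ m := pow_le_pow_left₀ (by norm_num) h3 m
      _ = _ := by
        rw [← Real.exp_nat_mul]
        congr 1
        ring
  have hhalf : Real.exp (-h) ≤ (1 / 2 : ℝ) ^ h := by
    have h3 : Real.exp (-1) ≤ 1 / 2 := by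
      have := Real.add_one_le_exp (1 : ℝ)
      rw [Real.exp_neg, one_div]
      exact inv_anti₀ (by norm_num) (by linarith)
    calc _ = Real.exp (-1) ^ h := by rw [← Real.exp_nat_mul]; simp
      _ ≤ _ := pow_le_pow_left₀ (Real.exp_pos _).le h3 h
  have hh : (h : ℝ) ≤ ε * n / 46656 := by
    have h3 : (h : ℝ) ≤ k := by exact_mod_cast hhk.le
    have h4 : ε * (ε * n) ≤ 1 / (512 * 3) * (ε * n) := by gcongr
    nlinarith
  calc (n : ℝ) ^ 4 * (1 - 1 / 81 / 2) ^ m ≤ (n : ℝ) ^ 4 * Real.exp (-(m / 162)) := by gcongr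
    _ ≤ (n : ℝ) ^ 4 * Real.exp (-(ε / 4000 * n) + (1 - h)) := by
      gcongr
      linarith
    _ = ((n : ℝ) ^ 4 * Real.exp (-(ε / 4000 * n))) * Real.exp (1 - h) := by
      rw [Real.exp_add, mul_assoc]
    _ < Real.exp (-1) * Real.exp (1 - h) := by gcongr
    _ = Real.exp (-h) := by
      rw [← Real.exp_add]
      congr 1
      ring
    _ ≤ _ := hhalf

/-- **Absorbing cycle lemma.** For `0 < ε < 2⁻⁹·3⁻¹` there is `n₀` such that
any edge-coloured graph on `n ≥ n₀` vertices with `δ₁^c(G) ≥ (2/3 + ε)n` has a properly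
coloured cycle `C` of length at most `2εn/3` such that for any `k ≤ 8ε²n/243` vertex-disjoint
properly coloured paths avoiding `V(C)`, some properly coloured cycle has vertex set exactly
`V(C)` together with the vertices of the paths. -/
theorem stmt18 (ε : ℝ) (hε0 : 0 < ε) (hε1 : ε < 1 / (512 * 3)) :
    ∃ n₀ : ℕ, ∀ (V : Type) [Fintype V] (G : SimpleGraph V) (c : V → V → ℕ),
      (∀ u v, c u v = c v u) →
      n₀ ≤ Fintype.card V →
      (∀ (v : V) (a : ℕ), (2 / 3 + ε) * (Fintype.card V : ℝ) ≤ colourDeg1 G c v a) →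
      ∃ C : List V, IsPCCycle G c C ∧
        (C.length : ℝ) ≤ 2 * ε * (Fintype.card V : ℝ) / 3 ∧
        ∀ (k : ℕ) (P : Fin k → List V),
          (k : ℝ) ≤ 8 * ε ^ 2 * (Fintype.card V : ℝ) / 243 →
          (∀ i, P i ≠ [] ∧ IsPCPath G c (P i)) →
          (∀ i, ∀ v ∈ P i, v ∉ C) →
          (∀ i j, i ≠ j → ∀ v ∈ P i, v ∉ P j) →
          ∃ C' : List V, IsPCCycle G c C' ∧
            (∀ v : V, v ∈ C' ↔ (v ∈ C ∨ ∃ i, v ∈ P i)) := by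
  classical
  obtain ⟨n₀, hn₀⟩ := exists_threshold hε0 hε1
  refine ⟨n₀, fun V _ G c hc hn hd => ?_⟩
  obtain ⟨h36, hlarge⟩ := hn₀ _ hn
  have hne : Nonempty V := by
    rw [← Fintype.card_pos_iff, Nat.pos_iff_ne_zero]
    intro h0
    rw [h0] at h36
    norm_num at h36
  set m := ⌊ε * Fintype.card V / 18⌋₊ with hmdef
  have hm : (m : ℝ) ≤ ε * Fintype.card V / 18 := Nat.floor_le (by positivity)
  have hm2 : 2 ≤ m := Nat.le_floor (by push_cast; linarith)
  obtain ⟨L, hL, hlen, hsum⟩ := exists_list_hitting (IsQuadFamily G c) (QuadAbsorbs G c)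
    (γ := 1 / 81) (by norm_num) (by norm_num) ⟨by simp, by simp⟩ m fun L hL hlt t =>
      le_card_quadAbsorbs hε0 hd hc hL (by
        have : (L.length : ℝ) ≤ m := by exact_mod_cast hlt.le
        linarith) t
  have hLm : (L.length : ℝ) = m := by rw [hlen]
  obtain ⟨⟨b, d, a, e⟩, L', rfl⟩ := List.exists_cons_of_length_pos (l := L) (by omega)
  have hab : G.Adj a b := (hL.2 _ (List.mem_cons_self ..)).1
  obtain ⟨I, hIL, hIn, hIw, -⟩ := exists_linked_blocks hε0 hd hc hab _ hL
    (U := (List.flatMap quadVerts ((b, d, a, e) :: L')).toFinset) (by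
      have h1 := List.toFinset_card_le (List.flatMap quadVerts ((b, d, a, e) :: L'))
      have h2 : (List.flatMap quadVerts ((b, d, a, e) :: L')).length = 4 * m := by
        rw [← hlen]
        simp only [List.length_flatMap, quadVerts, List.length_cons, List.length_nil,
          List.map_const', List.sum_replicate, smul_eq_mul]
        ring
      rw [h2] at h1
      rify at h1
      rw [hLm]
      linarith) (fun v hv => List.mem_toFinset.2 hv)
  have hIlen : I.length = m := by rw [← hlen, ← hIL, List.length_map]
  have hlenC : (I.flatMap (quadBlock fun _ => [])).length = 6 * m := by
    rw [length_flatMap_quadBlock, hIlen]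
  have htake : (I.flatMap (quadBlock fun _ => [])).take 2 = [a, b] := by
    rcases I with _ | ⟨⟨q, p, r⟩, I⟩
    · simp at hIL
    · simp only [List.map_cons, List.cons.injEq] at hIL
      simp [quadBlock, hIL.1]
  have hC : IsPCCycle G c (I.flatMap (quadBlock fun _ => [])) :=
    ⟨by omega, hIn, by rw [htake]; exact hIw⟩
  refine ⟨_, hC, ?_, fun k P hk hP hPC hPP => ?_⟩
  · rw [hlenC]
    push_cast
    linarith
  · refine exists_absorbing_cycle hc (hIL ▸ hL.nodup) (hIL ▸ hL.2) hC hP hPC hPP fun t => ?_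
    rw [hIL]
    by_contra! hlt
    have h1 := hlarge k _ hlt hk
    have h2 := Finset.single_le_sum (f := fun t => (1 / 2 : ℝ) ^
      (((b, d, a, e) :: L').countP fun ω => QuadAbsorbs G c t ω))
      (fun t _ => by positivity) (Finset.mem_univ t)
    refine absurd (h1.trans_le (h2.trans hsum)) (not_lt.2 (le_of_eq ?_))
    simp only [Fintype.card_prod, Nat.cast_mul]
    ring
end
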